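/- Let S ⊂ V(G) be a subset of vertices with S ∪ bS = V(G). Then for every f ∈ L₂(G) one has ‖f‖ ≤ (Σ_{u∈S} (2·d₀(u) + 1)·|f(u)|²)^{1/2} + 2·‖L^{1/2} f‖. -/

import Mathlib

open scoped BigOperators

variable {V : Type*}

noncomputable def lapl (G : SimpleGraph V) [DecidableRel G.Adj] [G.LocallyFinite]
    (f : V → ℂ) (v : V) : ℂ :=
  ∑ u ∈ G.neighborFinset v, (f v - f u)

noncomputable def l2norm (f : V → ℂ) : ℝ :=
  Real.sqrt (∑' v, ‖f v‖ ^ 2)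

noncomputable def dirichlet (G : SimpleGraph V) [DecidableRel G.Adj] [G.LocallyFinite]
    (f : V → ℂ) : ℝ :=
  (∑' v, lapl G f v * (starRingEnd ℂ) (f v)).re

def bdry (G : SimpleGraph V) (S : Set V) : Set V :=
  {v | v ∉ S ∧ ∃ u ∈ S, G.Adj u v}

noncomputable def d0 (G : SimpleGraph V) (S : Set V) (u : V) : ℕ :=
  {w | w ∈ bdry G S ∧ G.Adj u w}.ncard

/-- A sum restricted to the neighbors of `v` is a finite sum. -/
theorem tsum_ite_adj {E : Type*} [AddCommMonoid E] [TopologicalSpace E]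
    (G : SimpleGraph V) [DecidableRel G.Adj] [G.LocallyFinite] (F : V → E) (v : V) :
    ∑' u, (if G.Adj v u then F u else 0) = ∑ u ∈ G.neighborFinset v, F u := by
  rw [tsum_eq_sum (s := G.neighborFinset v)]
  · exact Finset.sum_congr rfl fun u hu => if_pos ((G.mem_neighborFinset v u).1 hu)
  · exact fun u hu => if_neg fun h => hu ((G.mem_neighborFinset v u).2 h)

theorem summable_ite_adj_left (G : SimpleGraph V) [DecidableRel G.Adj] [G.LocallyFinite]
    {D : ℕ} (hD : ∀ v, G.degree v ≤ D) {a : V → ℝ} (ha : ∀ v, 0 ≤ a v) (hs : Summable a) :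
    Summable fun p : V × V => if G.Adj p.1 p.2 then a p.1 else 0 := by
  rw [summable_prod_of_nonneg]
  · refine ⟨fun v => ?_, ?_⟩
    · refine summable_of_ne_finset_zero (s := G.neighborFinset v) fun u hu => ?_
      exact if_neg fun h => hu ((G.mem_neighborFinset v u).2 h)
    · refine Summable.of_nonneg_of_le (fun v => tsum_nonneg fun u => ?_) (fun v => ?_)
        (hs.mul_left (D : ℝ))
      · dsimp only
        split_ifs
        exacts [ha v, le_rfl]
      · dsimp only
        rw [tsum_ite_adj G (fun _ => a v) v, Finset.sum_const, nsmul_eq_mul,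
          G.card_neighborFinset_eq_degree]
        have : (G.degree v : ℝ) ≤ D := by exact_mod_cast hD v
        exact mul_le_mul_of_nonneg_right this (ha v)
  · intro p
    dsimp only [Pi.zero_apply]
    split_ifs
    exacts [ha _, le_rfl]

theorem summable_ite_adj_right (G : SimpleGraph V) [DecidableRel G.Adj] [G.LocallyFinite]
    {D : ℕ} (hD : ∀ v, G.degree v ≤ D) {a : V → ℝ} (ha : ∀ v, 0 ≤ a v) (hs : Summable a) :
    Summable fun p : V × V => if G.Adj p.1 p.2 then a p.2 else 0 := by
  refine ((Equiv.prodComm V V).summable_iff.2 (summable_ite_adj_left G hD ha hs)).congr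
    fun p => ?_
  simp [G.adj_comm]

theorem norm_sub_sq_le_two_mul (a b : ℂ) : ‖a - b‖ ^ 2 ≤ 2 * ‖a‖ ^ 2 + 2 * ‖b‖ ^ 2 := by
  nlinarith [norm_sub_le a b, norm_nonneg (a - b), sq_nonneg (‖a‖ - ‖b‖)]

theorem norm_sq_le_two_mul_add (a b : ℂ) : ‖a‖ ^ 2 ≤ 2 * ‖b‖ ^ 2 + 2 * ‖a - b‖ ^ 2 := by
  have h := norm_add_le b (a - b)
  rw [add_sub_cancel] at h
  nlinarith [norm_nonneg a, sq_nonneg (‖b‖ - ‖a - b‖)]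

theorem summable_energy (G : SimpleGraph V) [DecidableRel G.Adj] [G.LocallyFinite]
    {D : ℕ} (hD : ∀ v, G.degree v ≤ D) {f : V → ℂ} (hs : Summable fun v => ‖f v‖ ^ 2) :
    Summable fun p : V × V => if G.Adj p.1 p.2 then ‖f p.1 - f p.2‖ ^ 2 else 0 := by
  have hnn : ∀ v, 0 ≤ ‖f v‖ ^ 2 := fun v => by positivity
  refine Summable.of_nonneg_of_le (fun p => ?_) (fun p => ?_)
    (((summable_ite_adj_left G hD hnn hs).mul_left 2).add
      ((summable_ite_adj_right G hD hnn hs).mul_left 2))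
  · split_ifs <;> positivity
  · split_ifs
    · exact norm_sub_sq_le_two_mul _ _
    · simp

/-- The quadratic form of the Laplacian is half the sum of the squared differences along
oriented edges. -/
theorem two_mul_dirichlet (G : SimpleGraph V) [DecidableRel G.Adj] [G.LocallyFinite]
    {D : ℕ} (hD : ∀ v, G.degree v ≤ D) {f : V → ℂ} (hs : Summable fun v => ‖f v‖ ^ 2) :
    2 * dirichlet G f =
      ∑' p : V × V, if G.Adj p.1 p.2 then ‖f p.1 - f p.2‖ ^ 2 else 0 := by
  have hnn : ∀ v, 0 ≤ ‖f v‖ ^ 2 := fun v => by positivity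
  set P : V × V → ℂ := fun p =>
    if G.Adj p.1 p.2 then (f p.1 - f p.2) * (starRingEnd ℂ) (f p.1) else 0 with hP
  have hPs : Summable P := by
    refine Summable.of_norm_bounded
      ((summable_energy G hD hs).add (summable_ite_adj_left G hD hnn hs)) fun p => ?_
    simp only [hP]
    split_ifs
    · rw [norm_mul, RCLike.norm_conj]
      nlinarith [sq_nonneg (‖f p.1 - f p.2‖ - ‖f p.1‖), norm_nonneg (f p.1),
        norm_nonneg (f p.1 - f p.2)]
    · simp
  have hdir : dirichlet G f = (∑' p, P p).re := by
    rw [hPs.tsum_prod, dirichlet]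
    congr 2
    funext v
    simp only [hP]
    rw [tsum_ite_adj G (fun u => (f v - f u) * (starRingEnd ℂ) (f v)) v, lapl, Finset.sum_mul]
  have hre : Summable fun p => (P p).re := Complex.reCLM.summable hPs
  have hswap : ∑' p : V × V, (P p.swap).re = ∑' p, (P p).re :=
    (Equiv.prodComm V V).tsum_eq fun p => (P p).re
  have hreswap : Summable fun p : V × V => (P p.swap).re :=
    (Equiv.prodComm V V).summable_iff.2 hre
  rw [hdir, Complex.re_tsum hPs, two_mul]
  nth_rewrite 2 [← hswap]
  rw [← hre.tsum_add hreswap]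
  refine tsum_congr fun p => ?_
  simp only [hP, Prod.fst_swap, Prod.snd_swap, G.adj_comm p.2 p.1]
  split_ifs
  · rw [← Complex.normSq_eq_norm_sq, Complex.normSq_apply]
    simp only [Complex.mul_re, Complex.sub_re, Complex.sub_im, Complex.conj_re, Complex.conj_im]
    ring
  · simp

open scoped Classical in
theorem tsum_boundary_ite (G : SimpleGraph V) [DecidableRel G.Adj] [G.LocallyFinite]
    {S : Set V} {u : V} (hu : u ∈ S) (c : ℝ) :
    ∑' v, (if G.Adj u v ∧ v ∉ S then c else 0) = d0 G S u * c := by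
  have hset : {w | w ∈ bdry G S ∧ G.Adj u w} = ↑((G.neighborFinset u).filter (· ∉ S)) := by
    ext w
    simp only [bdry, Set.mem_ofPred_eq, Finset.coe_filter, SimpleGraph.mem_neighborFinset]
    exact ⟨fun h => ⟨h.2, h.1.1⟩, fun h => ⟨⟨h.2, u, hu, h.1⟩, h.1⟩⟩
  rw [d0, hset, Set.ncard_coe_finset, ← nsmul_eq_mul, ← Finset.sum_const,
    tsum_eq_sum (s := (G.neighborFinset u).filter (· ∉ S))]
  · refine Finset.sum_congr rfl fun v hv => if_pos ?_
    simpa using hv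
  · refine fun v hv => if_neg fun h => hv ?_
    simpa using h

open scoped Classical in
theorem tsum_norm_sq_le (G : SimpleGraph V) [DecidableRel G.Adj] [G.LocallyFinite]
    {D : ℕ} (hD : ∀ v, G.degree v ≤ D) {S : Set V} (hcover : S ∪ bdry G S = Set.univ)
    {f : V → ℂ} (hs : Summable fun v => ‖f v‖ ^ 2) :
    ∑' v, ‖f v‖ ^ 2 ≤
      (∑' u : S, (2 * (d0 G S u : ℝ) + 1) * ‖f u‖ ^ 2) + 4 * dirichlet G f := by
  have hnn : ∀ v, 0 ≤ ‖f v‖ ^ 2 := fun v => by positivity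
  have hen := summable_energy G hD hs
  -- `B (u, v)` is the mass of `u ∈ S` carried by each boundary edge `u v`.
  set B : V × V → ℝ := fun p =>
    if p.1 ∈ S then (if G.Adj p.1 p.2 ∧ p.2 ∉ S then ‖f p.1‖ ^ 2 else 0) else 0 with hB
  set e : V × V → ℝ := fun p => if G.Adj p.1 p.2 then ‖f p.1 - f p.2‖ ^ 2 else 0 with he
  have hBnn : ∀ p, 0 ≤ B p := fun p => by
    simp only [hB]; split_ifs <;> positivity
  have henn : ∀ p, 0 ≤ e p := fun p => by
    simp only [he]; split_ifs <;> positivity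
  have hBs : Summable B := by
    refine Summable.of_nonneg_of_le hBnn (fun p => ?_) (summable_ite_adj_left G hD hnn hs)
    simp only [hB]
    by_cases h : G.Adj p.1 p.2 <;> simp only [h, true_and, false_and, if_true, if_false, ite_self]
    · split_ifs <;> simp
    · exact le_rfl
  have hBswap : Summable fun p : V × V => B p.swap := (Equiv.prodComm V V).summable_iff.2 hBs
  have hk : Summable fun p : V × V => 2 * B p.swap + 2 * e p :=
    (hBswap.mul_left 2).add (hen.mul_left 2)
  have hBrow : ∀ u, ∑' v, B (u, v) = S.indicator (fun u => d0 G S u * ‖f u‖ ^ 2) u := by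
    intro u
    by_cases hu : u ∈ S
    · simp only [hB, hu, if_true, Set.indicator_of_mem]
      exact tsum_boundary_ite G hu _
    · simp [hB, hu]
  have hBtot : ∑' p : V × V, B p.swap = ∑' u, S.indicator (fun u => d0 G S u * ‖f u‖ ^ 2) u := by
    rw [show ∑' p : V × V, B p.swap = ∑' p, B p from (Equiv.prodComm V V).tsum_eq B,
      hBs.tsum_prod]
    exact tsum_congr hBrow
  have hd0s : Summable (S.indicator fun u => (d0 G S u : ℝ) * ‖f u‖ ^ 2) :=
    hBs.prod.congr fun u => (hBrow u)
  have hSs : Summable (S.indicator fun u => ‖f u‖ ^ 2) := hs.indicator S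
  have hcompl : ∀ v, ‖f v‖ ^ 2 ≤
      S.indicator (fun u => ‖f u‖ ^ 2) v + ∑' u, (2 * B (v, u).swap + 2 * e (v, u)) := by
    intro v
    have hknn : ∀ u, 0 ≤ 2 * B (v, u).swap + 2 * e (v, u) := fun u => by
      have := hBnn (v, u).swap
      have := henn (v, u)
      positivity
    by_cases hv : v ∈ S
    · rw [Set.indicator_of_mem hv]
      exact le_add_of_nonneg_right (tsum_nonneg hknn)
    · have hvb : v ∈ bdry G S := by
        have : v ∈ S ∪ bdry G S := hcover ▸ Set.mem_univ v
        exact this.resolve_left hv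
      obtain ⟨-, u, hu, huv⟩ := hvb
      rw [Set.indicator_of_notMem hv, zero_add]
      refine le_trans ?_ ((hk.prod_factor v).le_tsum u fun w _ => hknn w)
      simp only [hB, he, Prod.swap, hu, huv, huv.symm, hv, not_false_eq_true, and_self, if_true]
      exact norm_sq_le_two_mul_add _ _
  calc ∑' v, ‖f v‖ ^ 2
      ≤ ∑' v, (S.indicator (fun u => ‖f u‖ ^ 2) v +
          ∑' u, (2 * B (v, u).swap + 2 * e (v, u))) :=
        hs.tsum_le_tsum hcompl (hSs.add hk.prod)
    _ = (∑' u, S.indicator (fun u => ‖f u‖ ^ 2) u) +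
          (2 * (∑' u, S.indicator (fun u => d0 G S u * ‖f u‖ ^ 2) u) + 2 * ∑' p, e p) := by
        rw [hSs.tsum_add hk.prod, ← hk.tsum_prod,
          (hBswap.mul_left 2).tsum_add (hen.mul_left 2), tsum_mul_left, tsum_mul_left, hBtot]
    _ = _ := by
        rw [← two_mul_dirichlet G hD hs,
          tsum_subtype S fun u => (2 * (d0 G S u : ℝ) + 1) * ‖f u‖ ^ 2, ← add_assoc,
          ← tsum_mul_left, ← hSs.tsum_add (hd0s.mul_left 2)]
        congr 1
        · refine tsum_congr fun u => ?_
          by_cases hu : u ∈ S <;> simp [hu]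
          ring
        · ring

theorem stmt3 [Countable V] (G : SimpleGraph V) [DecidableRel G.Adj] [G.LocallyFinite]
    (hconn : G.Connected) (D : ℕ) (hD : ∀ v, G.degree v ≤ D)
    (S : Set V) (hcover : S ∪ bdry G S = Set.univ)
    (f : V → ℂ) (hf : Memℓp f 2) :
    l2norm f ≤ Real.sqrt (∑' u : S, (2 * (d0 G S u : ℝ) + 1) * ‖f u‖ ^ 2)
      + 2 * Real.sqrt (dirichlet G f) := by
  have hs : Summable fun v => ‖f v‖ ^ 2 := by
    simpa using hf.summable (by norm_num)
  have hA : 0 ≤ ∑' u : S, (2 * (d0 G S u : ℝ) + 1) * ‖f u‖ ^ 2 :=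
    tsum_nonneg fun u => by positivity
  have hE : 0 ≤ dirichlet G f := by
    have h : 0 ≤ 2 * dirichlet G f := by
      rw [two_mul_dirichlet G hD hs]
      exact tsum_nonneg fun p => by split_ifs <;> positivity
    linarith
  refine Real.sqrt_le_iff.2 ⟨by positivity, (tsum_norm_sq_le G hD hcover hs).trans ?_⟩
  nlinarith [Real.sq_sqrt hA, Real.sq_sqrt hE,
    mul_nonneg (Real.sqrt_nonneg (∑' u : S, (2 * (d0 G S u : ℝ) + 1) * ‖f u‖ ^ 2))
      (Real.sqrt_nonneg (dirichlet G f))]
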